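/- arXiv:math/0701829 — 7 statements merged into one kernel-verified Lean document; each statement's English description precedes it below -/
import Mathlib

section
/- For every integer m ≥ 1, the group presented by generators a₁, b₁, a₂, b₂, c, d, α₁, α₂, α₃, α₄ and relations [b₁⁻¹,d⁻¹] = a₁, [a₁⁻¹,d] = b₁, [d⁻¹,b₂⁻¹] = c, [c⁻¹,b₂] = d, [a₁,c] = 1, [b₁,c] = 1, [a₂,c] = 1, [a₂,d] = 1, [a₁,b₁][a₂,b₂] = 1, α₃ = [α₁⁻¹,α₄⁻¹], α₄ = [α₁,α₃⁻¹]^m, [α₂,α₃] = 1, [α₂,α₄] = 1, a₁ = α₁, b₁ = α₂, a₂ = α₃², b₂ = α₄, and [c,d] = [α₃,α₄]⁻¹ is the trivial group. -/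
/-!
STATEMENT 0: For every integer m ≥ 1, the group presented by generators
a₁, b₁, a₂, b₂, c, d, α₁, α₂, α₃, α₄ and the listed relations is trivial.
Here [x,y] = x·y·x⁻¹·y⁻¹, and a relation w = v corresponds to the relator w·v⁻¹.
-/

namespace Stmt0

inductive Gen : Type
  | a1 | b1 | a2 | b2 | c | d | α1 | α2 | α3 | α4

open Gen

/-- The generator of the free group corresponding to a letter. -/
def g (x : Gen) : FreeGroup Gen := FreeGroup.of x

/-- Commutator [x,y] = x·y·x⁻¹·y⁻¹. -/
def B (x y : FreeGroup Gen) : FreeGroup Gen := x * y * x⁻¹ * y⁻¹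

/-- The relators of the presentation, depending on m. -/
def rels (m : ℕ) : Set (FreeGroup Gen) :=
  { B (g b1)⁻¹ (g d)⁻¹ * (g a1)⁻¹,            -- [b₁⁻¹,d⁻¹] = a₁
    B (g a1)⁻¹ (g d) * (g b1)⁻¹,              -- [a₁⁻¹,d] = b₁
    B (g d)⁻¹ (g b2)⁻¹ * (g c)⁻¹,             -- [d⁻¹,b₂⁻¹] = c
    B (g c)⁻¹ (g b2) * (g d)⁻¹,               -- [c⁻¹,b₂] = d
    B (g a1) (g c),                            -- [a₁,c] = 1
    B (g b1) (g c),                            -- [b₁,c] = 1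
    B (g a2) (g c),                            -- [a₂,c] = 1
    B (g a2) (g d),                            -- [a₂,d] = 1
    B (g a1) (g b1) * B (g a2) (g b2),        -- [a₁,b₁][a₂,b₂] = 1
    g α3 * (B (g α1)⁻¹ (g α4)⁻¹)⁻¹,           -- α₃ = [α₁⁻¹,α₄⁻¹]
    g α4 * ((B (g α1) (g α3)⁻¹) ^ m)⁻¹,       -- α₄ = [α₁,α₃⁻¹]^m
    B (g α2) (g α3),                           -- [α₂,α₃] = 1
    B (g α2) (g α4),                           -- [α₂,α₄] = 1
    g a1 * (g α1)⁻¹,                           -- a₁ = α₁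
    g b1 * (g α2)⁻¹,                           -- b₁ = α₂
    g a2 * ((g α3) ^ 2)⁻¹,                     -- a₂ = α₃²
    g b2 * (g α4)⁻¹,                           -- b₂ = α₄
    B (g c) (g d) * ((B (g α3) (g α4))⁻¹)⁻¹ } -- [c,d] = [α₃,α₄]⁻¹

/-- In any group, elements satisfying the relations below are all trivial: `b` commutes with
`c` and `t`, hence with `d = [c⁻¹, t]`, and the other elements collapse in turn. -/
theorem eq_one_of_relations {G : Type*} [Group G] {a b c d s t : G} {m : ℕ}
    (ha : b⁻¹ * d⁻¹ * b⁻¹⁻¹ * d⁻¹⁻¹ = a) (hb : a⁻¹ * d * a⁻¹⁻¹ * d⁻¹ = b)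
    (hc : d⁻¹ * t⁻¹ * d⁻¹⁻¹ * t⁻¹⁻¹ = c) (hd : c⁻¹ * t * c⁻¹⁻¹ * t⁻¹ = d)
    (hbc : Commute b c) (hbt : Commute b t)
    (hs : s = a⁻¹ * t⁻¹ * a⁻¹⁻¹ * t⁻¹⁻¹) (ht : t = (a * s⁻¹ * a⁻¹ * s⁻¹⁻¹) ^ m) :
    a = 1 ∧ b = 1 ∧ c = 1 ∧ d = 1 ∧ s = 1 ∧ t = 1 := by
  have hbd : Commute b d := by
    rw [← hd]
    exact ((hbc.inv_right.mul_right hbt).mul_right hbc.inv_right.inv_right).mul_right hbt.inv_right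
  have ha1 : a = 1 := by
    rw [← ha, hbd.inv_inv.eq]
    group
  subst ha1
  have hb1 : b = 1 := by simpa using hb.symm
  have hs1 : s = 1 := by simpa using hs
  have ht1 : t = 1 := by simpa [hs1] using ht
  have hc1 : c = 1 := by simpa [ht1] using hc.symm
  have hd1 : d = 1 := by simpa [ht1] using hd.symm
  exact ⟨rfl, hb1, hc1, hd1, hs1, ht1⟩

/-- A homomorphism from the free group that kills every relator is trivial. -/
theorem hom_eq_one_of_rels {G : Type*} [Group G] {m : ℕ} (φ : FreeGroup Gen →* G)
    (hrel : ∀ r ∈ rels m, φ r = 1) : φ = 1 := by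
  simp only [rels, Set.mem_insert_iff, Set.mem_singleton_iff, forall_eq_or_imp, forall_eq, B,
    map_mul, map_inv, map_pow, mul_inv_eq_one] at hrel
  obtain ⟨h1, h2, h3, h4, -, h6, -, -, -, h10, h11, -, h13, h14, h15, h16, h17, -⟩ := hrel
  rw [← h14] at h10 h11
  rw [← h15] at h13
  rw [← h17] at h10 h11 h13
  obtain ⟨ha, hb, hc, hd, hs, ht⟩ := eq_one_of_relations h1 h2 h3 h4
    (mul_inv_eq_iff_eq_mul.mp h6) (mul_inv_eq_iff_eq_mul.mp h13) h10 h11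
  refine FreeGroup.ext_hom _ _ fun x => ?_
  change φ (g x) = 1
  cases x with
  | a1 => exact ha
  | b1 => exact hb
  | a2 => rw [h16, hs, one_pow]
  | b2 => exact ht
  | c => exact hc
  | d => exact hd
  | α1 => rw [← h14, ha]
  | α2 => rw [← h15, hb]
  | α3 => exact hs
  | α4 => rw [← h17, ht]

/-- The presented group is trivial for every m ≥ 1. -/
theorem presentedGroup_trivial (m : ℕ) (hm : 1 ≤ m) :
    ∀ x : PresentedGroup (rels m), x = 1 := by
  intro x
  obtain ⟨w, rfl⟩ := PresentedGroup.mk_surjective (rels m) x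
  rw [hom_eq_one_of_rels (PresentedGroup.mk (rels m)) fun r hr => PresentedGroup.one_of_mem hr,
    MonoidHom.one_apply]

end Stmt0
end

section
/- For all integers p ≥ 0 and m ≥ 1, the group presented by generators a₁, b₁, a₂, b₂, c, d, α₁, α₂, α₃, α₄ and relations [b₁⁻¹,d⁻¹] = a₁, [a₁⁻¹,d] = b₁, [d⁻¹,b₂⁻¹] = c^p, [c⁻¹,b₂] = d, [a₁,c] = 1, [b₁,c] = 1, [a₂,c] = 1, [a₂,d] = 1, [a₁,b₁][a₂,b₂] = 1, α₃ = [α₁⁻¹,α₄⁻¹], α₄ = [α₁,α₃⁻¹]^m, [α₂,α₃] = 1, [α₂,α₄] = 1, a₁ = α₁, b₁ = α₂, a₂ = α₃², b₂ = α₄, and [c,d] = [α₃,α₄]⁻¹ is isomorphic to the cyclic group ℤ/p (where ℤ/0 denotes the infinite cyclic group ℤ), generated by the image of c. -/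
/-!
STATEMENT 1: For all integers p ≥ 0 and m ≥ 1, the group presented by
generators a₁, b₁, a₂, b₂, c, d, α₁, α₂, α₃, α₄ and the listed relations is
isomorphic to the cyclic group ℤ/p (with ℤ/0 = ℤ), generated by the image of c.
Here ℤ/p is formalized as `Multiplicative (ZMod p)` (note `ZMod 0 = ℤ`).
-/

namespace Stmt1

inductive Gen : Type
  | a1 | b1 | a2 | b2 | c | d | α1 | α2 | α3 | α4

open Gen

/-- The generator of the free group corresponding to a letter. -/
def g (x : Gen) : FreeGroup Gen := FreeGroup.of x

/-- Commutator [x,y] = x·y·x⁻¹·y⁻¹. -/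
def B (x y : FreeGroup Gen) : FreeGroup Gen := x * y * x⁻¹ * y⁻¹

/-- The relators of the presentation, depending on p and m. -/
def rels (p m : ℕ) : Set (FreeGroup Gen) :=
  { B (g b1)⁻¹ (g d)⁻¹ * (g a1)⁻¹,            -- [b₁⁻¹,d⁻¹] = a₁
    B (g a1)⁻¹ (g d) * (g b1)⁻¹,              -- [a₁⁻¹,d] = b₁
    B (g d)⁻¹ (g b2)⁻¹ * ((g c) ^ p)⁻¹,       -- [d⁻¹,b₂⁻¹] = c^p
    B (g c)⁻¹ (g b2) * (g d)⁻¹,               -- [c⁻¹,b₂] = d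
    B (g a1) (g c),                            -- [a₁,c] = 1
    B (g b1) (g c),                            -- [b₁,c] = 1
    B (g a2) (g c),                            -- [a₂,c] = 1
    B (g a2) (g d),                            -- [a₂,d] = 1
    B (g a1) (g b1) * B (g a2) (g b2),        -- [a₁,b₁][a₂,b₂] = 1
    g α3 * (B (g α1)⁻¹ (g α4)⁻¹)⁻¹,           -- α₃ = [α₁⁻¹,α₄⁻¹]
    g α4 * ((B (g α1) (g α3)⁻¹) ^ m)⁻¹,       -- α₄ = [α₁,α₃⁻¹]^m
    B (g α2) (g α3),                           -- [α₂,α₃] = 1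
    B (g α2) (g α4),                           -- [α₂,α₄] = 1
    g a1 * (g α1)⁻¹,                           -- a₁ = α₁
    g b1 * (g α2)⁻¹,                           -- b₁ = α₂
    g a2 * ((g α3) ^ 2)⁻¹,                     -- a₂ = α₃²
    g b2 * (g α4)⁻¹,                           -- b₂ = α₄
    B (g c) (g d) * ((B (g α3) (g α4))⁻¹)⁻¹ } -- [c,d] = [α₃,α₄]⁻¹

/-- A homomorphism killing the relators kills every generator other than `c`,
and maps `c` to an element whose `p`-th power is trivial. -/
theorem eq_one_of_rels_eq_one {G : Type*} [Group G] {p m : ℕ} (f : FreeGroup Gen →* G)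
    (hf : ∀ r ∈ rels p m, f r = 1) :
    (∀ x, x ≠ c → f (g x) = 1) ∧ f (g c) ^ p = 1 := by
  simp only [rels, B, Set.mem_insert_iff, Set.mem_singleton_iff, forall_eq_or_imp, forall_eq,
    map_mul, map_inv, map_pow, inv_inv] at hf
  obtain ⟨hx, hy, hcp, hd, -, hyc, -, -, -, hs, ht, hys, hyt, hxx, hyy, ha2, hb2, -⟩ := hf
  rw [mul_inv_eq_one] at hx hy hcp hd hs ht hxx hyy ha2 hb2
  rw [mul_inv_eq_one, mul_inv_eq_iff_eq_mul] at hyc hys hyt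
  have b1_comm_d : Commute (f (g b1)) (f (g d)) := by
    have hc : Commute (f (g b1)) (f (g c)) := hyc
    have hb : Commute (f (g b1)) (f (g b2)) := by rw [hyy, hb2]; exact hyt
    rw [← hd]
    exact ((hc.inv_right.mul_right hb).mul_right hc).mul_right hb.inv_right
  have a1_eq : f (g a1) = 1 := by
    rw [← hx, b1_comm_d.inv_inv.eq]; group
  have b1_eq : f (g b1) = 1 := by
    rw [← hy, a1_eq]; group
  have α1_eq : f (g α1) = 1 := by rw [← hxx, a1_eq]
  have α2_eq : f (g α2) = 1 := by rw [← hyy, b1_eq]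
  have α3_eq : f (g α3) = 1 := by rw [hs, α1_eq]; group
  have α4_eq : f (g α4) = 1 := by rw [ht, α1_eq, α3_eq]; simp
  have a2_eq : f (g a2) = 1 := by rw [ha2, α3_eq, one_pow]
  have b2_eq : f (g b2) = 1 := by rw [hb2, α4_eq]
  have d_eq : f (g d) = 1 := by rw [← hd, b2_eq]; group
  refine ⟨fun x hx => ?_, by rw [← hcp, d_eq]; group⟩
  cases x <;> first | assumption | exact absurd rfl hx

open Classical in
/-- The homomorphism onto `ℤ/p` sending `c` to `1` and every other generator to `0`. -/
noncomputable def toZMod (p m : ℕ) : PresentedGroup (rels p m) →* Multiplicative (ZMod p) :=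
  PresentedGroup.toGroup
    (f := fun x => if x = Gen.c then Multiplicative.ofAdd (1 : ZMod p) else 1) (by
      simp [rels, B, g, ← ofAdd_nsmul])

theorem toZMod_of_c (p m : ℕ) :
    toZMod p m (PresentedGroup.of Gen.c) = Multiplicative.ofAdd (1 : ZMod p) := by
  simp [toZMod]

theorem of_eq_one {p m : ℕ} {x : Gen} (hx : x ≠ c) :
    PresentedGroup.of (rels := rels p m) x = 1 :=
  (eq_one_of_rels_eq_one (PresentedGroup.mk (rels p m))
    fun _ => PresentedGroup.one_of_mem).1 x hx

theorem of_c_pow (p m : ℕ) : PresentedGroup.of (rels := rels p m) Gen.c ^ p = 1 :=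
  (eq_one_of_rels_eq_one (PresentedGroup.mk (rels p m))
    fun _ => PresentedGroup.one_of_mem).2

theorem mem_zpowers_of_c {p m : ℕ} (y : PresentedGroup (rels p m)) :
    y ∈ Subgroup.zpowers (PresentedGroup.of (rels := rels p m) Gen.c) := by
  have h : Subgroup.closure (Set.range (PresentedGroup.of (rels := rels p m))) ≤
      Subgroup.zpowers (PresentedGroup.of Gen.c) := by
    rw [Subgroup.closure_le]
    rintro _ ⟨x, rfl⟩
    by_cases hx : x = c
    · rw [hx]
      exact Subgroup.mem_zpowers _
    · rw [of_eq_one hx]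
      exact one_mem _
  rw [PresentedGroup.closure_range_of] at h
  exact h (Subgroup.mem_top y)

theorem toZMod_of_c_zpow (p m : ℕ) (k : ℤ) :
    toZMod p m (PresentedGroup.of Gen.c ^ k) = Multiplicative.ofAdd (k : ZMod p) := by
  rw [map_zpow, toZMod_of_c, ← ofAdd_zsmul, zsmul_one]

theorem toZMod_bijective (p m : ℕ) : Function.Bijective (toZMod p m) := by
  constructor
  · rw [injective_iff_map_eq_one]
    intro y hy
    obtain ⟨k, rfl⟩ := Subgroup.mem_zpowers_iff.1 (mem_zpowers_of_c y)
    rw [toZMod_of_c_zpow, ofAdd_eq_one, ZMod.intCast_zmod_eq_zero_iff_dvd] at hy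
    obtain ⟨j, rfl⟩ := hy
    rw [zpow_mul, zpow_natCast, of_c_pow, one_zpow]
  · intro z
    obtain ⟨k, hk⟩ := ZMod.intCast_surjective z.toAdd
    exact ⟨PresentedGroup.of Gen.c ^ k, by rw [toZMod_of_c_zpow, hk, ofAdd_toAdd]⟩

/-- The presented group is isomorphic to ℤ/p (with ℤ/0 = ℤ),
generated by the image of c. -/
theorem presentedGroup_cyclic (p m : ℕ) (hm : 1 ≤ m) :
    ∃ φ : PresentedGroup (rels p m) ≃* Multiplicative (ZMod p),
      φ (PresentedGroup.of (rels := rels p m) Gen.c) =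
        Multiplicative.ofAdd (1 : ZMod p) := by
  exact ⟨MulEquiv.ofBijective (toZMod p m) (toZMod_bijective p m), toZMod_of_c p m⟩

end Stmt1
end

section
/- For all integers n ≥ 2 and m ≥ 1, the group presented by generators a₁, b₁, a₂, b₂, c₁, …, c_n, d₁, …, d_n, α₁, α₂, α₃, α₄ and relations [b₁⁻¹,d₁⁻¹] = a₁, [a₁⁻¹,d₁] = b₁, [b₂⁻¹,d₂⁻¹] = a₂, [a₂⁻¹,d₂] = b₂, [d₁⁻¹,b₂⁻¹] = c₁, [c₁⁻¹,b₂] = d₁, [d₂⁻¹,b₁⁻¹] = c₂, [c₂⁻¹,b₁]^m = d₂, [a₁,c₁] = 1, [a₁,c₂] = 1, [a₁,d₂] = 1, [b₁,c₁] = 1, [a₂,c₁] = 1, [a₂,c₂] = 1, [a₂,d₁] = 1, [b₂,c₂] = 1, [a₁,b₁][a₂,b₂] = 1, together with [a₁⁻¹,d_j⁻¹] = c_j, [a₂⁻¹,c_j⁻¹] = d_j, [b₁,c_j] = 1, [b₂,d_j] = 1 for each j with 3 ≤ j ≤ n, and the relations α₃ = [α₁⁻¹,α₄⁻¹], [α₁,α₃]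 = 1, [α₂,α₃] = 1, [α₂,α₄] = 1, a₁ = α₁, b₁ = α₂, a₂ = α₃², b₂ = α₄, and (∏_{j=1}^{n}[c_j,d_j]) = [α₃,α₄]⁻¹, is the trivial group. -/
/-!
STATEMENT 2: For all integers n ≥ 2 and m ≥ 1, the group presented by
generators a₁, b₁, a₂, b₂, c₁, …, c_n, d₁, …, d_n, α₁, α₂, α₃, α₄ and the
listed relations is the trivial group.  The generators c_j, d_j are indexed
by `Fin n`, with `⟨0,_⟩` corresponding to the subscript 1, so the condition
"3 ≤ j ≤ n" becomes "2 ≤ (j : ℕ)".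
-/

namespace Stmt2

inductive Gen (n : ℕ) : Type
  | a1 | b1 | a2 | b2
  | c (j : Fin n) | d (j : Fin n)
  | α1 | α2 | α3 | α4

/-- The generator of the free group corresponding to a letter. -/
def g {n : ℕ} (x : Gen n) : FreeGroup (Gen n) := FreeGroup.of x

/-- Commutator [x,y] = x·y·x⁻¹·y⁻¹. -/
def B {n : ℕ} (x y : FreeGroup (Gen n)) : FreeGroup (Gen n) := x * y * x⁻¹ * y⁻¹

/-- The relators of the presentation, depending on n ≥ 2 and m. -/
def rels (n : ℕ) (hn : 2 ≤ n) (m : ℕ) : Set (FreeGroup (Gen n)) :=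
  let c1 := g (Gen.c (⟨0, by omega⟩ : Fin n))
  let c2 := g (Gen.c (⟨1, by omega⟩ : Fin n))
  let d1 := g (Gen.d (⟨0, by omega⟩ : Fin n))
  let d2 := g (Gen.d (⟨1, by omega⟩ : Fin n))
  ({ B (g Gen.b1)⁻¹ d1⁻¹ * (g Gen.a1)⁻¹,       -- [b₁⁻¹,d₁⁻¹] = a₁
     B (g Gen.a1)⁻¹ d1 * (g Gen.b1)⁻¹,          -- [a₁⁻¹,d₁] = b₁
     B (g Gen.b2)⁻¹ d2⁻¹ * (g Gen.a2)⁻¹,        -- [b₂⁻¹,d₂⁻¹] = a₂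
     B (g Gen.a2)⁻¹ d2 * (g Gen.b2)⁻¹,          -- [a₂⁻¹,d₂] = b₂
     B d1⁻¹ (g Gen.b2)⁻¹ * c1⁻¹,                -- [d₁⁻¹,b₂⁻¹] = c₁
     B c1⁻¹ (g Gen.b2) * d1⁻¹,                  -- [c₁⁻¹,b₂] = d₁
     B d2⁻¹ (g Gen.b1)⁻¹ * c2⁻¹,                -- [d₂⁻¹,b₁⁻¹] = c₂
     (B c2⁻¹ (g Gen.b1)) ^ m * d2⁻¹,            -- [c₂⁻¹,b₁]^m = d₂
     B (g Gen.a1) c1,                            -- [a₁,c₁] = 1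
     B (g Gen.a1) c2,                            -- [a₁,c₂] = 1
     B (g Gen.a1) d2,                            -- [a₁,d₂] = 1
     B (g Gen.b1) c1,                            -- [b₁,c₁] = 1
     B (g Gen.a2) c1,                            -- [a₂,c₁] = 1
     B (g Gen.a2) c2,                            -- [a₂,c₂] = 1
     B (g Gen.a2) d1,                            -- [a₂,d₁] = 1
     B (g Gen.b2) c2,                            -- [b₂,c₂] = 1
     B (g Gen.a1) (g Gen.b1) * B (g Gen.a2) (g Gen.b2), -- [a₁,b₁][a₂,b₂] = 1
     g Gen.α3 * (B (g Gen.α1)⁻¹ (g Gen.α4)⁻¹)⁻¹, -- α₃ = [α₁⁻¹,α₄⁻¹]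
     B (g Gen.α1) (g Gen.α3),                    -- [α₁,α₃] = 1
     B (g Gen.α2) (g Gen.α3),                    -- [α₂,α₃] = 1
     B (g Gen.α2) (g Gen.α4),                    -- [α₂,α₄] = 1
     g Gen.a1 * (g Gen.α1)⁻¹,                    -- a₁ = α₁
     g Gen.b1 * (g Gen.α2)⁻¹,                    -- b₁ = α₂
     g Gen.a2 * ((g Gen.α3) ^ 2)⁻¹,              -- a₂ = α₃²
     g Gen.b2 * (g Gen.α4)⁻¹,                    -- b₂ = α₄
     -- (∏_{j=1}^{n} [c_j,d_j]) = [α₃,α₄]⁻¹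
     ((List.finRange n).map (fun j => B (g (Gen.c j)) (g (Gen.d j)))).prod *
       ((B (g Gen.α3) (g Gen.α4))⁻¹)⁻¹ } : Set (FreeGroup (Gen n))) ∪
  ⋃ (j : Fin n), ⋃ (_ : 2 ≤ (j : ℕ)),
    ({ B (g Gen.a1)⁻¹ (g (Gen.d j))⁻¹ * (g (Gen.c j))⁻¹, -- [a₁⁻¹,d_j⁻¹] = c_j
       B (g Gen.a2)⁻¹ (g (Gen.c j))⁻¹ * (g (Gen.d j))⁻¹, -- [a₂⁻¹,c_j⁻¹] = d_j
       B (g Gen.b1) (g (Gen.c j)),                        -- [b₁,c_j] = 1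
       B (g Gen.b2) (g (Gen.d j)) } : Set (FreeGroup (Gen n)))

/-- A homomorphism that kills all the relators kills every generator. -/
theorem map_of_eq_one {H : Type*} [Group H] (n : ℕ) (hn : 2 ≤ n) (m : ℕ)
    (f : FreeGroup (Gen n) →* H) (hf : ∀ r ∈ rels n hn m, f r = 1) (x : Gen n) :
    f (g x) = 1 := by
  simp only [rels, Set.mem_union, Set.mem_insert_iff, Set.mem_singleton_iff, Set.mem_iUnion,
    or_imp, forall_and, forall_eq, exists_prop, forall_exists_index, and_imp] at hf
  obtain ⟨⟨ha1, hb1, -, hb2, hc1, hd1, hc2, hd2, -, -, ha1d2, -, -, -, -, -, -, hα3, ha1α3, -, -,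
    ha1', hb1', ha2', hb2', -⟩, hcj, hdj, -, -⟩ := hf
  simp only [B, map_mul, map_inv, map_pow, mul_inv_eq_one, inv_inv]
    at ha1 hb1 hb2 hc1 hd1 hc2 hd2 ha1d2 hα3 ha1α3 ha1' hb1' ha2' hb2' hcj hdj
  have hcomm : Commute (f (g Gen.a1)) (f (g Gen.b2)) := by
    have h2 : Commute (f (g Gen.a1)) (f (g Gen.a2)) := by
      rw [ha1', ha2']
      exact Commute.pow_right (mul_inv_eq_iff_eq_mul.mp ha1α3) 2
    have hd : Commute (f (g Gen.a1)) (f (g (Gen.d ⟨1, by omega⟩))) :=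
      mul_inv_eq_iff_eq_mul.mp ha1d2
    rw [← hb2]
    exact ((h2.inv_right.mul_right hd).mul_right h2).mul_right hd.inv_right
  have α3 : f (g Gen.α3) = 1 := by
    rw [hα3, ← ha1', ← hb2', hcomm.inv_inv.eq]
    group
  have a2 : f (g Gen.a2) = 1 := by rw [ha2', α3, one_pow]
  have b2 : f (g Gen.b2) = 1 := by rw [← hb2, a2]; group
  have c1 : f (g (Gen.c ⟨0, by omega⟩)) = 1 := by rw [← hc1, b2]; group
  have d1 : f (g (Gen.d ⟨0, by omega⟩)) = 1 := by rw [← hd1, b2]; group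
  have a1 : f (g Gen.a1) = 1 := by rw [← ha1, d1]; group
  have b1 : f (g Gen.b1) = 1 := by rw [← hb1, d1]; group
  have c2 : f (g (Gen.c ⟨1, by omega⟩)) = 1 := by rw [← hc2, b1]; group
  have d2 : f (g (Gen.d ⟨1, by omega⟩)) = 1 := by rw [← hd2, b1, c2]; simp
  cases x with
  | a1 => exact a1
  | b1 => exact b1
  | a2 => exact a2
  | b2 => exact b2
  | c j =>
    obtain ⟨_ | _ | k, hk⟩ := j
    · exact c1
    · exact c2
    · simpa [a1, eq_comm] using hcj _ ⟨k + 2, hk⟩ (Nat.le_add_left 2 k) rfl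
  | d j =>
    obtain ⟨_ | _ | k, hk⟩ := j
    · exact d1
    · exact d2
    · simpa [a2, eq_comm] using hdj _ ⟨k + 2, hk⟩ (Nat.le_add_left 2 k) rfl
  | α1 => rw [← ha1', a1]
  | α2 => rw [← hb1', b1]
  | α3 => exact α3
  | α4 => rw [← hb2', b2]

/-- The presented group is trivial for all n ≥ 2 and m ≥ 1. -/
theorem presentedGroup_trivial (n : ℕ) (hn : 2 ≤ n) (m : ℕ) (hm : 1 ≤ m) :
    ∀ x : PresentedGroup (rels n hn m), x = 1 := by
  have h : PresentedGroup.mk (rels n hn m) = 1 :=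
    FreeGroup.ext_hom _ _ fun x =>
      map_of_eq_one n hn m _ (fun _ hr => PresentedGroup.one_of_mem hr) x
  intro x
  obtain ⟨w, rfl⟩ := PresentedGroup.mk_surjective _ x
  rw [h, MonoidHom.one_apply]

end Stmt2
end

section
/- For every integer m ≥ 1, the group presented by generators α₁, α₂, α₃, α₄ and relations α₃ = [α₁⁻¹,α₄⁻¹], α₄ = [α₁,α₃⁻¹]^m, [α₂,α₃] = 1, [α₂,α₄] = 1, α₁ = [α₂⁻¹,α₄⁻¹], and α₂ = [α₁⁻¹,α₄] is the trivial group. -/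
/-!
STATEMENT 3: For every integer m ≥ 1, the group presented by generators
α₁, α₂, α₃, α₄ and relations α₃ = [α₁⁻¹,α₄⁻¹], α₄ = [α₁,α₃⁻¹]^m,
[α₂,α₃] = 1, [α₂,α₄] = 1, α₁ = [α₂⁻¹,α₄⁻¹], α₂ = [α₁⁻¹,α₄]
is the trivial group.
-/

namespace Stmt3

inductive Gen : Type
  | α1 | α2 | α3 | α4

open Gen

/-- The generator of the free group corresponding to a letter. -/
def g (x : Gen) : FreeGroup Gen := FreeGroup.of x

/-- Commutator [x,y] = x·y·x⁻¹·y⁻¹. -/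
def B (x y : FreeGroup Gen) : FreeGroup Gen := x * y * x⁻¹ * y⁻¹

/-- The relators of the presentation, depending on m. -/
def rels (m : ℕ) : Set (FreeGroup Gen) :=
  { g α3 * (B (g α1)⁻¹ (g α4)⁻¹)⁻¹,        -- α₃ = [α₁⁻¹,α₄⁻¹]
    g α4 * ((B (g α1) (g α3)⁻¹) ^ m)⁻¹,    -- α₄ = [α₁,α₃⁻¹]^m
    B (g α2) (g α3),                        -- [α₂,α₃] = 1
    B (g α2) (g α4),                        -- [α₂,α₄] = 1
    g α1 * (B (g α2)⁻¹ (g α4)⁻¹)⁻¹,        -- α₁ = [α₂⁻¹,α₄⁻¹]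
    g α2 * (B (g α1)⁻¹ (g α4))⁻¹ }         -- α₂ = [α₁⁻¹,α₄]

/-- The presented group is trivial for every m ≥ 1. -/
theorem presentedGroup_trivial (m : ℕ) (hm : 1 ≤ m) :
    ∀ x : PresentedGroup (rels m), x = 1 := by
  have rel {r : FreeGroup Gen} (hr : r ∈ rels m) : PresentedGroup.mk (rels m) r = 1 :=
    PresentedGroup.one_of_mem hr
  have h₃ := rel (r := g α3 * (B (g α1)⁻¹ (g α4)⁻¹)⁻¹) (by simp [rels])
  have h₄ := rel (r := g α4 * ((B (g α1) (g α3)⁻¹) ^ m)⁻¹) (by simp [rels])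
  have h₂₄ := rel (r := B (g α2) (g α4)) (by simp [rels])
  have h₁ := rel (r := g α1 * (B (g α2)⁻¹ (g α4)⁻¹)⁻¹) (by simp [rels])
  have h₂ := rel (r := g α2 * (B (g α1)⁻¹ (g α4))⁻¹) (by simp [rels])
  simp only [B, map_mul, map_inv, map_pow] at h₃ h₄ h₂₄ h₁ h₂
  have hcomm : Commute (PresentedGroup.mk (rels m) (g α2)) (PresentedGroup.mk (rels m) (g α4)) :=
    commutatorElement_eq_one_iff_commute.mp h₂₄
  have e₁ : PresentedGroup.mk (rels m) (g α1) = 1 := by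
    rw [← commutatorElement_def, commutatorElement_eq_one_iff_commute.mpr hcomm.inv_inv] at h₁
    simpa using h₁
  have e₃ : PresentedGroup.mk (rels m) (g α3) = 1 := by simpa [e₁] using h₃
  have e₂ : PresentedGroup.mk (rels m) (g α2) = 1 := by simpa [e₁] using h₂
  have e₄ : PresentedGroup.mk (rels m) (g α4) = 1 := by simpa [e₁, e₃] using h₄
  have hmk : PresentedGroup.mk (rels m) = 1 := by
    ext x
    cases x
    exacts [e₁, e₂, e₃, e₄]
  intro x
  obtain ⟨w, rfl⟩ := PresentedGroup.mk_surjective (rels m) x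
  exact DFunLike.congr_fun hmk w

end Stmt3
end

section
/- For every integer m ≥ 1, the group presented by generators α₁, α₂, α₃, α₄ and relations α₃ = [α₁⁻¹,α₄⁻¹], α₄ = [α₁,α₃⁻¹]^m, [α₂,α₃] = 1, [α₂,α₄] = 1, α₄ = α₂⁻¹, [α₁,α₂] = 1, and α₁ = α₃⁻² is the trivial group. -/
/-!
STATEMENT 4: For every integer m ≥ 1, the group presented by generators
α₁, α₂, α₃, α₄ and relations α₃ = [α₁⁻¹,α₄⁻¹], α₄ = [α₁,α₃⁻¹]^m,
[α₂,α₃] = 1, [α₂,α₄] = 1, α₄ = α₂⁻¹, [α₁,α₂] = 1, α₁ = α₃⁻²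
is the trivial group.
-/

namespace Stmt4

inductive Gen : Type
  | α1 | α2 | α3 | α4

open Gen

/-- The generator of the free group corresponding to a letter. -/
def g (x : Gen) : FreeGroup Gen := FreeGroup.of x

/-- Commutator [x,y] = x·y·x⁻¹·y⁻¹. -/
def B (x y : FreeGroup Gen) : FreeGroup Gen := x * y * x⁻¹ * y⁻¹

/-- The relators of the presentation, depending on m. -/
def rels (m : ℕ) : Set (FreeGroup Gen) :=
  { g α3 * (B (g α1)⁻¹ (g α4)⁻¹)⁻¹,        -- α₃ = [α₁⁻¹,α₄⁻¹]
    g α4 * ((B (g α1) (g α3)⁻¹) ^ m)⁻¹,    -- α₄ = [α₁,α₃⁻¹]^m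
    B (g α2) (g α3),                        -- [α₂,α₃] = 1
    B (g α2) (g α4),                        -- [α₂,α₄] = 1
    g α4 * ((g α2)⁻¹)⁻¹,                    -- α₄ = α₂⁻¹
    B (g α1) (g α2),                        -- [α₁,α₂] = 1
    g α1 * (((g α3)⁻¹) ^ 2)⁻¹ }             -- α₁ = α₃⁻²

/-- A homomorphism out of the free group that kills all the relators is trivial. -/
theorem eq_one_of_forall_mem_rels {G : Type*} [Group G] (m : ℕ) (f : FreeGroup Gen →* G)
    (hf : ∀ r ∈ rels m, f r = 1) : f = 1 := by
  simp only [rels, Set.mem_insert_iff, Set.mem_singleton_iff, forall_eq_or_imp, forall_eq, B,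
    map_mul, map_inv, map_pow, inv_inv] at hf
  obtain ⟨h3, h4, -, -, h42, h12, h1⟩ := hf
  rw [mul_inv_eq_one] at h3 h4 h1
  have hcomm : Commute (f (g α1)) (f (g α2)) := by
    rwa [mul_inv_eq_one, mul_inv_eq_iff_eq_mul] at h12
  have h14 : Commute (f (g α1))⁻¹ (f (g α4)) := by
    rw [eq_inv_of_mul_eq_one_left h42]
    exact hcomm.inv_inv
  have hα3 : f (g α3) = 1 := by
    rw [h3, h14.inv_right.eq]
    group
  have hα1 : f (g α1) = 1 := by simpa [hα3] using h1
  have hα4 : f (g α4) = 1 := by simpa [hα1, hα3] using h4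
  have hα2 : f (g α2) = 1 := by simpa [hα4] using h42
  ext i
  cases i
  exacts [hα1, hα2, hα3, hα4]

/-- The presented group is trivial for every m ≥ 1. -/
theorem presentedGroup_trivial (m : ℕ) (hm : 1 ≤ m) :
    ∀ x : PresentedGroup (rels m), x = 1 := by
  intro x
  obtain ⟨w, rfl⟩ := PresentedGroup.mk_surjective (rels m) x
  rw [eq_one_of_forall_mem_rels m (PresentedGroup.mk (rels m))
    fun _ hr => PresentedGroup.one_of_mem hr, MonoidHom.one_apply]

end Stmt4
end

section
/- For all integers n ≥ 2 and m ≥ 1, the group presented by generators a₁, b₁, a₂, b₂, c₁, …, c_n, d₁, …, d_n and relations [b₁⁻¹,d₁⁻¹] = a₁, [a₁⁻¹,d₁] = b₁, [b₂⁻¹,d₂⁻¹] = a₂, [a₂⁻¹,d₂] = b₂, [d₁⁻¹,b₂⁻¹] = c₁, [c₁⁻¹,b₂] = d₁, [d₂⁻¹,b₁⁻¹] = c₂, [c₂⁻¹,b₁]^m = d₂, [a₁,c₁] = 1, [a₁,c₂] = 1, [a₁,d₂] = 1, [b₁,c₁] = 1, [a₂,c₁] = 1, [a₂,c₂] = 1,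 [a₂,d₁] = 1, [b₂,c₂] = 1, [a₁,b₁][a₂,b₂] = 1, ∏_{j=1}^{n}[c_j,d_j] = 1, together with [a₁⁻¹,d_j⁻¹] = c_j, [a₂⁻¹,c_j⁻¹] = d_j, [b₁,c_j] = 1, [b₂,d_j] = 1 for each j with 3 ≤ j ≤ n, has trivial abelianization. -/
/-!
STATEMENT 5: For all integers n ≥ 2 and m ≥ 1, the group presented by
generators a₁, b₁, a₂, b₂, c₁, …, c_n, d₁, …, d_n and the listed relations
(the fundamental group of Y_n(m)) has trivial abelianization.
The generators c_j, d_j are indexed by `Fin n`, with `⟨0,_⟩` corresponding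
to the subscript 1, so the condition "3 ≤ j ≤ n" becomes "2 ≤ (j : ℕ)".
-/

namespace Stmt5

inductive Gen (n : ℕ) : Type
  | a1 | b1 | a2 | b2
  | c (j : Fin n) | d (j : Fin n)

/-- The generator of the free group corresponding to a letter. -/
def g {n : ℕ} (x : Gen n) : FreeGroup (Gen n) := FreeGroup.of x

/-- Commutator [x,y] = x·y·x⁻¹·y⁻¹. -/
def B {n : ℕ} (x y : FreeGroup (Gen n)) : FreeGroup (Gen n) := x * y * x⁻¹ * y⁻¹

/-- The relators of the presentation of π₁(Y_n(m)), for n ≥ 2. -/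
def rels (n : ℕ) (hn : 2 ≤ n) (m : ℕ) : Set (FreeGroup (Gen n)) :=
  let c1 := g (Gen.c (⟨0, by omega⟩ : Fin n))
  let c2 := g (Gen.c (⟨1, by omega⟩ : Fin n))
  let d1 := g (Gen.d (⟨0, by omega⟩ : Fin n))
  let d2 := g (Gen.d (⟨1, by omega⟩ : Fin n))
  ({ B (g Gen.b1)⁻¹ d1⁻¹ * (g Gen.a1)⁻¹,       -- [b₁⁻¹,d₁⁻¹] = a₁
     B (g Gen.a1)⁻¹ d1 * (g Gen.b1)⁻¹,          -- [a₁⁻¹,d₁] = b₁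
     B (g Gen.b2)⁻¹ d2⁻¹ * (g Gen.a2)⁻¹,        -- [b₂⁻¹,d₂⁻¹] = a₂
     B (g Gen.a2)⁻¹ d2 * (g Gen.b2)⁻¹,          -- [a₂⁻¹,d₂] = b₂
     B d1⁻¹ (g Gen.b2)⁻¹ * c1⁻¹,                -- [d₁⁻¹,b₂⁻¹] = c₁
     B c1⁻¹ (g Gen.b2) * d1⁻¹,                  -- [c₁⁻¹,b₂] = d₁
     B d2⁻¹ (g Gen.b1)⁻¹ * c2⁻¹,                -- [d₂⁻¹,b₁⁻¹] = c₂
     (B c2⁻¹ (g Gen.b1)) ^ m * d2⁻¹,            -- [c₂⁻¹,b₁]^m = d₂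
     B (g Gen.a1) c1,                            -- [a₁,c₁] = 1
     B (g Gen.a1) c2,                            -- [a₁,c₂] = 1
     B (g Gen.a1) d2,                            -- [a₁,d₂] = 1
     B (g Gen.b1) c1,                            -- [b₁,c₁] = 1
     B (g Gen.a2) c1,                            -- [a₂,c₁] = 1
     B (g Gen.a2) c2,                            -- [a₂,c₂] = 1
     B (g Gen.a2) d1,                            -- [a₂,d₁] = 1
     B (g Gen.b2) c2,                            -- [b₂,c₂] = 1
     B (g Gen.a1) (g Gen.b1) * B (g Gen.a2) (g Gen.b2), -- [a₁,b₁][a₂,b₂] = 1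
     -- ∏_{j=1}^{n} [c_j,d_j] = 1
     ((List.finRange n).map (fun j => B (g (Gen.c j)) (g (Gen.d j)))).prod }
       : Set (FreeGroup (Gen n))) ∪
  ⋃ (j : Fin n), ⋃ (_ : 2 ≤ (j : ℕ)),
    ({ B (g Gen.a1)⁻¹ (g (Gen.d j))⁻¹ * (g (Gen.c j))⁻¹, -- [a₁⁻¹,d_j⁻¹] = c_j
       B (g Gen.a2)⁻¹ (g (Gen.c j))⁻¹ * (g (Gen.d j))⁻¹, -- [a₂⁻¹,c_j⁻¹] = d_j
       B (g Gen.b1) (g (Gen.c j)),                        -- [b₁,c_j] = 1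
       B (g Gen.b2) (g (Gen.d j)) } : Set (FreeGroup (Gen n)))

/-- A homomorphism to a commutative group kills every commutator `B x y`. -/
theorem map_B {n : ℕ} {A : Type*} [CommGroup A] (f : FreeGroup (Gen n) →* A)
    (x y : FreeGroup (Gen n)) : f (B x y) = 1 := by
  simp [B, mul_comm (f x) (f y)]

/-- A homomorphism to a commutative group that kills the relators kills every generator. -/
theorem map_g_eq_one {n : ℕ} (hn : 2 ≤ n) (m : ℕ) {A : Type*} [CommGroup A]
    (f : FreeGroup (Gen n) →* A) (hf : ∀ r ∈ rels n hn m, f r = 1) (x : Gen n) :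
    f (g x) = 1 := by
  have key (k : ℕ) (u v w : FreeGroup (Gen n)) (h : B u v ^ k * w⁻¹ ∈ rels n hn m) :
      f w = 1 := by
    simpa [map_B] using hf _ h
  have key₁ (u v w : FreeGroup (Gen n)) (h : B u v * w⁻¹ ∈ rels n hn m) : f w = 1 :=
    key 1 u v w (by simpa only [pow_one] using h)
  cases x with
  | a1 => exact key₁ _ _ _ (Or.inl (Or.inl rfl))
  | b1 => exact key₁ _ _ _ (Or.inl (Or.inr (Or.inl rfl)))
  | a2 => exact key₁ _ _ _ (Or.inl (Or.inr (Or.inr (Or.inl rfl))))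
  | b2 => exact key₁ _ _ _ (Or.inl (Or.inr (Or.inr (Or.inr (Or.inl rfl)))))
  | c j =>
    obtain ⟨_ | _ | j, hj⟩ := j
    · exact key₁ _ _ _ (Or.inl (Or.inr (Or.inr (Or.inr (Or.inr (Or.inl rfl))))))
    · exact key₁ _ _ _ (Or.inl (Or.inr (Or.inr (Or.inr (Or.inr (Or.inr (Or.inr
        (Or.inl rfl))))))))
    · exact key₁ _ _ _ (Or.inr (Set.mem_iUnion₂.2 ⟨⟨j + 2, hj⟩, Nat.le_add_left 2 j,
        Or.inl rfl⟩))
  | d j =>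
    obtain ⟨_ | _ | j, hj⟩ := j
    · exact key₁ _ _ _ (Or.inl (Or.inr (Or.inr (Or.inr (Or.inr (Or.inr (Or.inl rfl)))))))
    · exact key m _ _ _ (Or.inl (Or.inr (Or.inr (Or.inr (Or.inr (Or.inr (Or.inr (Or.inr
        (Or.inl rfl)))))))))
    · exact key₁ _ _ _ (Or.inr (Set.mem_iUnion₂.2 ⟨⟨j + 2, hj⟩, Nat.le_add_left 2 j,
        Or.inr (Or.inl rfl)⟩))

/-- The presented group has trivial abelianization for all n ≥ 2 and m ≥ 1. -/
theorem presentedGroup_abelianization_trivial (n : ℕ) (hn : 2 ≤ n) (m : ℕ)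
    (hm : 1 ≤ m) :
    ∀ x : Abelianization (PresentedGroup (rels n hn m)), x = 1 := by
  let f := Abelianization.of.comp (PresentedGroup.mk (rels n hn m))
  have hf : f = 1 := FreeGroup.ext_hom _ _ <| map_g_eq_one hn m f fun r hr => by
    simp [f, PresentedGroup.one_of_mem hr]
  intro x
  obtain ⟨y, rfl⟩ := QuotientGroup.mk_surjective x
  obtain ⟨w, rfl⟩ := PresentedGroup.mk_surjective _ y
  exact DFunLike.congr_fun hf w

end Stmt5
end

section
/- Fix a real number r with 0 < r < 1/2, and let F̃ : ℝ² → ℝ⁴ be the smooth map F̃(s,t) = (1/2 + r·cos(π(2s+1)), 1/2 + r·sin(π(2s+1)), 2s, t). Let ω be the alternating bilinear form on ℝ⁴ given by ω((x₁,x₂,x₃,x₄),(y₁,y₂,y₃,y₄)) = x₁y₂ − x₂y₁ + x₃y₄ − x₄y₃. Then for every (s,t) ∈ ℝ², ω(∂F̃/∂s (s,t), ∂F̃/∂t (s,t)) = 2; in particular this value is nonzero everywhere. -/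
/-!
STATEMENT 7: Fix 0 < r < 1/2 and let F̃ : ℝ² → ℝ⁴ be the smooth map
F̃(s,t) = (1/2 + r·cos(π(2s+1)), 1/2 + r·sin(π(2s+1)), 2s, t).
Let ω be the standard symplectic form on ℝ⁴,
ω(x,y) = x₁y₂ − x₂y₁ + x₃y₄ − x₄y₃.  Then for every (s,t),
ω(∂F̃/∂s, ∂F̃/∂t) = 2; in particular this value is nonzero everywhere.

The partial derivatives are formalized as the Fréchet derivative applied to
the standard basis vectors (1,0) and (0,1) of ℝ².
-/

open Real

/-- The map F̃ : ℝ² → ℝ⁴. -/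
noncomputable def Ftilde (r : ℝ) : ℝ × ℝ → ℝ × ℝ × ℝ × ℝ :=
  fun p =>
    (1 / 2 + r * Real.cos (π * (2 * p.1 + 1)),
     1 / 2 + r * Real.sin (π * (2 * p.1 + 1)),
     2 * p.1, p.2)

/-- The standard alternating symplectic form ω = dx₁∧dx₂ + dx₃∧dx₄ on ℝ⁴. -/
def omegaForm (x y : ℝ × ℝ × ℝ × ℝ) : ℝ :=
  x.1 * y.2.1 - x.2.1 * y.1 + x.2.2.1 * y.2.2.2 - x.2.2.2 * y.2.2.1

theorem contDiff_Ftilde (r : ℝ) {n : WithTop ℕ∞} : ContDiff ℝ n (Ftilde r) := by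
  unfold Ftilde
  fun_prop

theorem hasFDerivAt_Ftilde (r s t : ℝ) :
    HasFDerivAt (Ftilde r)
      (((-(r * (2 * π) * sin (π * (2 * s + 1)))) • ContinuousLinearMap.fst ℝ ℝ ℝ).prod
        (((r * (2 * π) * cos (π * (2 * s + 1))) • ContinuousLinearMap.fst ℝ ℝ ℝ).prod
          (((2 : ℝ) • ContinuousLinearMap.fst ℝ ℝ ℝ).prod (ContinuousLinearMap.snd ℝ ℝ ℝ))))
      (s, t) := by
  have hfst : HasFDerivAt (Prod.fst : ℝ × ℝ → ℝ) (ContinuousLinearMap.fst ℝ ℝ ℝ) (s, t) :=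
    hasFDerivAt_fst
  have hangle : HasDerivAt (fun x : ℝ => π * (2 * x + 1)) (2 * π) s :=
    ((((hasDerivAt_id s).const_mul 2).add_const 1).const_mul π).congr_deriv (by ring)
  have hcos : HasDerivAt (fun x : ℝ => 1 / 2 + r * cos (π * (2 * x + 1)))
      (-(r * (2 * π) * sin (π * (2 * s + 1)))) s :=
    ((hangle.cos.const_mul r).const_add (1 / 2)).congr_deriv (by ring)
  have hsin : HasDerivAt (fun x : ℝ => 1 / 2 + r * sin (π * (2 * x + 1)))
      (r * (2 * π) * cos (π * (2 * s + 1))) s :=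
    ((hangle.sin.const_mul r).const_add (1 / 2)).congr_deriv (by ring)
  exact (hcos.comp_hasFDerivAt (s, t) hfst).prodMk
    ((hsin.comp_hasFDerivAt (s, t) hfst).prodMk ((hfst.const_mul 2).prodMk hasFDerivAt_snd))

theorem Ftilde_symplectic (r : ℝ) (hr0 : 0 < r) (hr : r < 1 / 2) :
    ContDiff ℝ (⊤ : ℕ∞) (Ftilde r) ∧
    ∀ s t : ℝ,
      omegaForm (fderiv ℝ (Ftilde r) (s, t) (1, 0))
          (fderiv ℝ (Ftilde r) (s, t) (0, 1)) = 2 ∧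
      omegaForm (fderiv ℝ (Ftilde r) (s, t) (1, 0))
          (fderiv ℝ (Ftilde r) (s, t) (0, 1)) ≠ 0 := by
  have h (s t : ℝ) : omegaForm (fderiv ℝ (Ftilde r) (s, t) (1, 0))
      (fderiv ℝ (Ftilde r) (s, t) (0, 1)) = 2 := by
    rw [(hasFDerivAt_Ftilde r s t).fderiv]
    simp [omegaForm]
  exact ⟨contDiff_Ftilde r, fun s t => ⟨h s t, by rw [h s t]; exact two_ne_zero⟩⟩
end
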